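/- Let p > 49 be a prime, h an integer with p ∤ h, and F a binary quartic form over 𝔽_p that is not of the form c·M(x,y)² for any quadratic form M over 𝔽_p and constant c (in particular F is nonzero and not a fourth power of a linear form times a constant). Then the projective curve h·z⁴ = F(x,y) over 𝔽_p has a smooth 𝔽_p-rational point. -/

import Mathlib

open Polynomial
section defs
variable {R : Type*} [CommRing R]
def qF0 (b0 b1 b2 b3 b4 x : R) : R := b0*x^4+4*b1*x^3+6*b2*x^2+4*b3*x+b4
def qF1 (b0 b1 b2 b3 b4 x X : R) : R :=
  (b0*x^3+3*b1*x^2+3*b2*x+b3)*X+(b1*x^3+3*b2*x^2+3*b3*x+b4)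
def qF2 (b0 b1 b2 b3 b4 x X : R) : R :=
  (b0*x^2+2*b1*x+b2)*X^2+2*(b1*x^2+2*b2*x+b3)*X+(b2*x^2+2*b3*x+b4)
def qH (b0 b1 b2 b3 b4 x : R) : R :=
  (b0*b2-b1^2)*x^4+2*(b0*b3-b1*b2)*x^3+(b0*b4+2*b1*b3-3*b2^2)*x^2+2*(b1*b4-b2*b3)*x+(b2*b4-b3^2)
def qJ (b0 b1 b2 b3 b4 x : R) : R :=
  (-2*b1^3+3*b0*b1*b2-b0^2*b3)*x^6+(-6*b1^2*b2+9*b0*b2^2-2*b0*b1*b3-b0^2*b4)*x^5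
  +(-10*b1^2*b3+15*b0*b2*b3-5*b0*b1*b4)*x^4+(-10*b1^2*b4+10*b0*b3^2)*x^3
  +(10*b1*b3^2-15*b1*b2*b4+5*b0*b3*b4)*x^2+(6*b2*b3^2-9*b2^2*b4+2*b1*b3*b4+b0*b4^2)*x
  +(2*b3^3-3*b2*b3*b4+b1*b4^2)
def qN1 (b0 b1 b2 b3 b4 x : R) : R :=
  (-2*b1^3+3*b0*b1*b2-b0^2*b3)*x^5+(-5*b1^2*b2+7*b0*b2^2-b0*b1*b3-b0^2*b4)*x^4
  +(-2*b1*b2^2-4*b1^2*b3+10*b0*b2*b3-4*b0*b1*b4)*x^3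
  +(-3*b2^3+4*b1*b2*b3-5*b1^2*b4+5*b0*b3^2-b0*b2*b4)*x^2
  +(-2*b2^2*b3+6*b1*b3^2-5*b1*b2*b4+b0*b3*b4)*x+(b2*b3^2-2*b2^2*b4+b1*b3*b4)
def qNa (b0 b1 b2 b3 b4 x : R) : R :=
  (-b1^2*b2+2*b0*b2^2-b0*b1*b3)*x^5+(2*b1*b2^2-6*b1^2*b3+5*b0*b2*b3-b0*b1*b4)*x^4
  +(3*b2^3-4*b1*b2*b3-5*b1^2*b4+5*b0*b3^2+b0*b2*b4)*x^3
  +(2*b2^2*b3+4*b1*b3^2-10*b1*b2*b4+4*b0*b3*b4)*x^2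
  +(5*b2*b3^2-7*b2^2*b4+b1*b3*b4+b0*b4^2)*x+(2*b3^3-3*b2*b3*b4+b1*b4^2)
def qN (b0 b1 b2 b3 b4 x X : R) : R := qNa b0 b1 b2 b3 b4 x + X * qN1 b0 b1 b2 b3 b4 x
def qK (b0 b1 b2 b3 b4 x : R) : R :=
  (b0*b4-4*b1*b3+3*b2^2)*(qF0 b0 b1 b2 b3 b4 x)^2 - 3*(qH b0 b1 b2 b3 b4 x)^2
def qM (b0 b1 b2 b3 b4 x X : R) : R :=
  6*qH b0 b1 b2 b3 b4 x*qF1 b0 b1 b2 b3 b4 x X-4*(X-x)*qJ b0 b1 b2 b3 b4 x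
def qα (b0 b1 b2 b3 b4 x X : R) : R :=
  qF1 b0 b1 b2 b3 b4 x X * qM b0 b1 b2 b3 b4 x X + 9*(X-x)^2*(qH b0 b1 b2 b3 b4 x)^2
def qA3 (b0 b1 b2 b3 b4 x X : R) : R := (qF0 b0 b1 b2 b3 b4 x)^2 * qM b0 b1 b2 b3 b4 x X
def qA2 (b0 b1 b2 b3 b4 x X : R) : R := qF0 b0 b1 b2 b3 b4 x * qα b0 b1 b2 b3 b4 x X
def qA1 (b0 b1 b2 b3 b4 x X : R) : R :=
  (qF1 b0 b1 b2 b3 b4 x X)^2 * qM b0 b1 b2 b3 b4 x X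
  + 18*(X-x)^2*(qH b0 b1 b2 b3 b4 x)^2*qF1 b0 b1 b2 b3 b4 x X
def qA0 (b0 b1 b2 b3 b4 x X : R) : R :=
  qF2 b0 b1 b2 b3 b4 x X * (6*qH b0 b1 b2 b3 b4 x*(qF1 b0 b1 b2 b3 b4 x X)^2
    - 4*(X-x)*qJ b0 b1 b2 b3 b4 x*qF1 b0 b1 b2 b3 b4 x X)
  + 21*(X-x)^2*(qH b0 b1 b2 b3 b4 x)^2*qF2 b0 b1 b2 b3 b4 x X
  + 4*(X-x)^3*qH b0 b1 b2 b3 b4 x*qN b0 b1 b2 b3 b4 x X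

variable (b0 b1 b2 b3 b4 x X : R)
lemma qid1 : qF0 b0 b1 b2 b3 b4 x * qF2 b0 b1 b2 b3 b4 x X
    = (qF1 b0 b1 b2 b3 b4 x X)^2 + (X-x)^2*qH b0 b1 b2 b3 b4 x := by
  unfold qF0 qF1 qF2 qH; ring
lemma qid2 : (qF0 b0 b1 b2 b3 b4 x)^3 * qF0 b0 b1 b2 b3 b4 X
    = (qF1 b0 b1 b2 b3 b4 x X)^4 + 6*(X-x)^2*qH b0 b1 b2 b3 b4 x*(qF1 b0 b1 b2 b3 b4 x X)^2
      + 4*(X-x)^3*qJ b0 b1 b2 b3 b4 x*qF1 b0 b1 b2 b3 b4 x X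
      + (X-x)^4*qK b0 b1 b2 b3 b4 x := by
  unfold qK qF0 qF1 qJ qH; ring
lemma qid3 : qF0 b0 b1 b2 b3 b4 x * qN b0 b1 b2 b3 b4 x X
    = qJ b0 b1 b2 b3 b4 x * qF1 b0 b1 b2 b3 b4 x X - 2*(X-x)*(qH b0 b1 b2 b3 b4 x)^2 := by
  unfold qN qNa qN1 qF0 qF1 qJ qH; ring
lemma qid4 : qF0 b0 b1 b2 b3 b4 x * qA0 b0 b1 b2 b3 b4 x X
    = (qF1 b0 b1 b2 b3 b4 x X)^3*qM b0 b1 b2 b3 b4 x X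
      + 27*(X-x)^2*(qH b0 b1 b2 b3 b4 x)^2*(qF1 b0 b1 b2 b3 b4 x X)^2
      + 13*(X-x)^4*(qH b0 b1 b2 b3 b4 x)^3 := by
  have h1 := qid1 b0 b1 b2 b3 b4 x X
  have h3 := qid3 b0 b1 b2 b3 b4 x X
  unfold qA0 qM
  set a := qF1 b0 b1 b2 b3 b4 x X
  set H := qH b0 b1 b2 b3 b4 x
  set J := qJ b0 b1 b2 b3 b4 x
  linear_combination (6*H*a^2-4*(X-x)*J*a+21*(X-x)^2*H^2)*h1 + 4*(X-x)^3*H*h3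
lemma qF1_diag : qF1 b0 b1 b2 b3 b4 x x = qF0 b0 b1 b2 b3 b4 x := by
  unfold qF1 qF0; ring
lemma qid5 : qH b0 b1 b2 b3 b4 x = qF0 b0 b1 b2 b3 b4 x * (b0*x^2+2*b1*x+b2)
    - (b0*x^3+3*b1*x^2+3*b2*x+b3)^2 := by
  unfold qH qF0; ring
end defs
open Polynomial
section loc
def qPsi {R : Type*} [CommRing R] (b0 b1 b2 b3 b4 x X u : R) : R :=
  qA0 b0 b1 b2 b3 b4 x X + qA1 b0 b1 b2 b3 b4 x X * u + qA2 b0 b1 b2 b3 b4 x X * u^2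
    + qA3 b0 b1 b2 b3 b4 x X * u^3

lemma cop_of_eval {K : Type*} [Field K] (c : K) (w : K[X]) (hw : w.eval c ≠ 0) (n : ℕ) :
    IsCoprime ((X - C c)^n) w := by
  apply IsCoprime.pow_left
  refine (Irreducible.coprime_iff_not_dvd (irreducible_X_sub_C c)).2 ?_
  rw [dvd_iff_isRoot]; exact hw

lemma local_div {K : Type*} [Field K] (h2 : (2:K) ≠ 0) (b0 b1 b2 b3 b4 c ι : K) (XX u : K[X])
    (hX : (X - C c) ∣ XX - X)
    (hu : u^4 * qF0 (C b0) (C b1) (C b2) (C b3) (C b4) X = qF0 (C b0) (C b1) (C b2) (C b3) (C b4) XX)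
    (hc : (qF0 (C b0) (C b1) (C b2) (C b3) (C b4) X).eval c ≠ 0)
    (hι : u.eval c = ι) (hs : 1 + ι + ι^2 + ι^3 = 0) :
    (X - C c)^4 ∣ qPsi (C b0) (C b1) (C b2) (C b3) (C b4) X XX u := by
  have hι4 : ι^4 = 1 := by linear_combination (ι - 1) * hs
  have hι0 : ι ≠ 0 := by rintro rfl; norm_num at hι4
  have e2 := qid2 (C b0) (C b1) (C b2) (C b3) (C b4) X XX
  have e4 := qid4 (C b0) (C b1) (C b2) (C b3) (C b4) X XX
  have hXc : XX.eval c = c := by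
    have := dvd_iff_isRoot.1 hX
    simpa [sub_eq_zero] using this
  have hF1c : (qF1 (C b0) (C b1) (C b2) (C b3) (C b4) X XX).eval c
      = (qF0 (C b0) (C b1) (C b2) (C b3) (C b4) X).eval c := by
    rw [← qF1_diag]; simp [qF1, hXc]
  unfold qPsi qA1 qA2 qA3 qα
  unfold qM at *
  set F := qF0 (C b0) (C b1) (C b2) (C b3) (C b4) X
  set a := qF1 (C b0) (C b1) (C b2) (C b3) (C b4) X XX
  set H := qH (C b0) (C b1) (C b2) (C b3) (C b4) X
  set J := qJ (C b0) (C b1) (C b2) (C b3) (C b4) X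
  set A := qA0 (C b0) (C b1) (C b2) (C b3) (C b4) X XX
  set Q := qK (C b0) (C b1) (C b2) (C b3) (C b4) X
  rw [← hu] at e2
  have hTc : (XX - X).eval c = 0 := by simp [hXc]
  have hT4 : (X - C c)^4 ∣ (XX - X)^4 := pow_dvd_pow_of_dvd hX 4
  set T := XX - X with hT
  set t := (X - C c)^4
  set y := C ι⁻¹ * (F * u) with hy
  have hyu : F * u = C ι * y := by
    rw [hy, ← mul_assoc, ← C_mul, mul_inv_cancel₀ hι0]; simp
  have hCι4 : C (ι⁻¹)^4 = (1 : K[X]) := by rw [← C_pow, inv_pow, hι4]; simp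
  have hy4 : y^4 = a^4 + 6*T^2*H*a^2+4*T^3*J*a+T^4*Q := by
    rw [hy]; linear_combination (F*u)^4 * hCι4 + e2
  have hyc : y.eval c = F.eval c := by
    rw [hy]; simp only [eval_mul, eval_C, hι]; field_simp
  have ha : a.eval c ≠ 0 := by rwa [hF1c]
  have hd : t ∣ 2*a^2*y - (2*a^3+3*T^2*H*a+2*T^3*J) := by
    set P := 2*a^2*y
    set S := (2*a^3+3*T^2*H*a+2*T^3*J) with hS
    have hPc : P.eval c = 2 * F.eval c^3 := by
      simp only [P, eval_mul, eval_pow, hyc, hF1c, eval_ofNat]; ring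
    have hSc : S.eval c = 2 * F.eval c^3 := by
      simp only [hS, eval_add, eval_mul, eval_pow, hF1c, hTc, eval_ofNat]; ring
    have hco : IsCoprime t ((P+S)*(P^2+S^2)) := by
      apply cop_of_eval
      simp only [eval_mul, eval_add, eval_pow, hPc, hSc]
      have : (2 * eval c F ^ 3 + 2 * eval c F ^ 3) * ((2 * eval c F ^ 3) ^ 2 + (2 * eval c F ^ 3) ^ 2)
         = 2^5 * (eval c F)^9 := by ring
      rw [this]; positivity
    apply hco.dvd_of_dvd_mul_right
    have : (P - S) * ((P + S) * (P^2+S^2)) = P^4 - S^4 := by ring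
    rw [this]
    refine hT4.trans ⟨16*a^8*Q - 24*a^6*(3*H*a+2*T*J)^2 - 8*a^3*T^2*(3*H*a+2*T*J)^3
      - T^4*(3*H*a+2*T*J)^4, ?_⟩
    simp only [P, hS]
    linear_combination 16*a^8*hy4
  have hco2 : IsCoprime t (2*a^2) := by
    apply cop_of_eval
    simp only [eval_mul, eval_pow, eval_ofNat]
    exact mul_ne_zero h2 (pow_ne_zero _ ha)
  set M := 6*H*a-4*T*J with hM
  have d1 : t ∣ M*y - (a*M+9*T^2*H^2) := by
    apply hco2.dvd_of_dvd_mul_left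
    have : 2*a^2*(M*y - (a*M+9*T^2*H^2)) = M*(2*a^2*y - (2*a^3+3*T^2*H*a+2*T^3*J))
      + T^4 * (-8*J^2) := by rw [hM]; ring
    rw [this]
    exact dvd_add (hd.mul_left _) (hT4.mul_right _)
  have d2 : t ∣ (a*M+9*T^2*H^2)*y - (a^2*M+18*T^2*H^2*a) := by
    apply hco2.dvd_of_dvd_mul_left
    have : 2*a^2*((a*M+9*T^2*H^2)*y - (a^2*M+18*T^2*H^2*a))
      = (a*M+9*T^2*H^2)*(2*a^2*y - (2*a^3+3*T^2*H*a+2*T^3*J))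
      + T^4 * (-8*a*J^2+9*H^2*(3*H*a+2*T*J)) := by rw [hM]; ring
    rw [this]
    exact dvd_add (hd.mul_left _) (hT4.mul_right _)
  have d3 : t ∣ (a^2*M+18*T^2*H^2*a)*y - F*A := by
    apply hco2.dvd_of_dvd_mul_left
    have : 2*a^2*((a^2*M+18*T^2*H^2*a)*y - F*A)
      = (a^2*M+18*T^2*H^2*a)*(2*a^2*y - (2*a^3+3*T^2*H*a+2*T^3*J))
      + T^4 * (-8*a^2*J^2+18*H^2*a*(3*H*a+2*T*J)-26*a^2*H^3) := by rw [e4, hM]; ring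
    rw [this]
    exact dvd_add (hd.mul_left _) (hT4.mul_right _)
  have hsC : 1 + C ι + C ι^2 + C ι^3 = (0 : K[X]) := by
    have := congrArg (C : K → K[X]) hs
    simpa using this
  apply (cop_of_eval c F hc 4).dvd_of_dvd_mul_left
  have key : F * (A + (a^2*M+18*T^2*H^2*a)*u + F*(a*M+9*T^2*H^2)*u^2 + F^2*M*u^3)
     = (C ι + C ι^2 + C ι^3) * ((a^2*M+18*T^2*H^2*a)*y - F*A)
       + (C ι^2*y + C ι^3*y) * ((a*M+9*T^2*H^2)*y - (a^2*M+18*T^2*H^2*a))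
       + C ι^3*y^2*(M*y - (a*M+9*T^2*H^2)) := by
    linear_combination F*A*hsC + (a^2*M+18*T^2*H^2*a)*hyu
      + (a*M+9*T^2*H^2) * (F*u+C ι*y) * hyu + M * ((F*u)^2+(F*u)*(C ι*y)+(C ι*y)^2)*hyu
  rw [key]
  exact dvd_add (dvd_add (d3.mul_left _) (d2.mul_left _)) (d1.mul_left _)
end loc
open Polynomial
section inf
variable {L : Type*} [Field L] (b0 b1 b2 b3 b4 s S : L)
lemma revF0 (hs : s ≠ 0) : qF0 b0 b1 b2 b3 b4 s⁻¹ * s^4 = qF0 b4 b3 b2 b1 b0 s := by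
  unfold qF0; field_simp; ring
lemma revF1 (hs : s ≠ 0) (hS : S ≠ 0) :
    qF1 b0 b1 b2 b3 b4 s⁻¹ S⁻¹ = qF1 b4 b3 b2 b1 b0 s S * (s⁻¹^3 * S⁻¹) := by
  unfold qF1; field_simp; ring
lemma revF2 (hs : s ≠ 0) (hS : S ≠ 0) :
    qF2 b0 b1 b2 b3 b4 s⁻¹ S⁻¹ = qF2 b4 b3 b2 b1 b0 s S * (s⁻¹^2 * S⁻¹^2) := by
  unfold qF2; field_simp; ring
lemma revF0' (hs : s ≠ 0) : qF0 b0 b1 b2 b3 b4 s⁻¹ = qF0 b4 b3 b2 b1 b0 s * s⁻¹^4 := by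
  unfold qF0; field_simp; ring
lemma revH (hs : s ≠ 0) : qH b0 b1 b2 b3 b4 s⁻¹ = qH b4 b3 b2 b1 b0 s * s⁻¹^4 := by
  unfold qH; field_simp; ring
lemma revJ (hs : s ≠ 0) : qJ b0 b1 b2 b3 b4 s⁻¹ = -qJ b4 b3 b2 b1 b0 s * s⁻¹^6 := by
  unfold qJ; field_simp; ring
lemma revN (hs : s ≠ 0) (hS : S ≠ 0) :
    qN b0 b1 b2 b3 b4 s⁻¹ S⁻¹ = -qN b4 b3 b2 b1 b0 s S * (s⁻¹^5 * S⁻¹) := by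
  unfold qN qNa qN1; field_simp; ring
lemma revT (hs : s ≠ 0) (hS : S ≠ 0) : S⁻¹ - s⁻¹ = -(S - s) * (s⁻¹ * S⁻¹) := by
  field_simp; ring
lemma revM (hs : s ≠ 0) (hS : S ≠ 0) :
    qM b0 b1 b2 b3 b4 s⁻¹ S⁻¹ = qM b4 b3 b2 b1 b0 s S * (s⁻¹^7 * S⁻¹) := by
  unfold qM
  rw [revH _ _ _ _ _ _ hs, revF1 _ _ _ _ _ _ _ hs hS, revJ _ _ _ _ _ _ hs, revT _ _ hs hS]; ring
lemma revA3 (hs : s ≠ 0) (hS : S ≠ 0) :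
    qA3 b0 b1 b2 b3 b4 s⁻¹ S⁻¹ = qA3 b4 b3 b2 b1 b0 s S * (s⁻¹^15 * S⁻¹) := by
  unfold qA3
  rw [revF0' _ _ _ _ _ _ hs, revM _ _ _ _ _ _ _ hs hS]; ring
lemma revA2 (hs : s ≠ 0) (hS : S ≠ 0) :
    qA2 b0 b1 b2 b3 b4 s⁻¹ S⁻¹ = qA2 b4 b3 b2 b1 b0 s S * (s⁻¹^14 * S⁻¹^2) := by
  unfold qA2 qα
  rw [revF0' _ _ _ _ _ _ hs, revM _ _ _ _ _ _ _ hs hS, revH _ _ _ _ _ _ hs,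
    revF1 _ _ _ _ _ _ _ hs hS, revT _ _ hs hS]; ring
lemma revA1 (hs : s ≠ 0) (hS : S ≠ 0) :
    qA1 b0 b1 b2 b3 b4 s⁻¹ S⁻¹ = qA1 b4 b3 b2 b1 b0 s S * (s⁻¹^13 * S⁻¹^3) := by
  unfold qA1
  rw [revM _ _ _ _ _ _ _ hs hS, revH _ _ _ _ _ _ hs,
    revF1 _ _ _ _ _ _ _ hs hS, revT _ _ hs hS]; ring
lemma revA0 (hs : s ≠ 0) (hS : S ≠ 0) :
    qA0 b0 b1 b2 b3 b4 s⁻¹ S⁻¹ = qA0 b4 b3 b2 b1 b0 s S * (s⁻¹^12 * S⁻¹^4) := by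
  unfold qA0
  rw [revH _ _ _ _ _ _ hs, revJ _ _ _ _ _ _ hs, revN _ _ _ _ _ _ _ hs hS,
    revF1 _ _ _ _ _ _ _ hs hS, revF2 _ _ _ _ _ _ _ hs hS, revT _ _ hs hS]; ring
lemma revPsi (u : L) (k : ℕ) (hs : s ≠ 0) :
    qPsi b0 b1 b2 b3 b4 s⁻¹ (s^(4*k+1))⁻¹ (u * (s⁻¹^(4*k))) * s^(16*k+16)
      = qPsi b4 b3 b2 b1 b0 s (s^(4*k+1)) u := by
  have hS : s^(4*k+1) ≠ 0 := pow_ne_zero _ hs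
  unfold qPsi
  rw [revA0 _ _ _ _ _ _ _ hs hS, revA1 _ _ _ _ _ _ _ hs hS, revA2 _ _ _ _ _ _ _ hs hS,
    revA3 _ _ _ _ _ _ _ hs hS]
  have e : s^(4*k+1) = s^(4*k) * s := pow_succ _ _
  have e2 : s^(16*k+16) = (s^(4*k))^4 * s^16 := by rw [← pow_mul, ← pow_add]; ring_nf
  generalize qA0 b4 b3 b2 b1 b0 s (s^(4*k+1)) = A0
  generalize qA1 b4 b3 b2 b1 b0 s (s^(4*k+1)) = A1
  generalize qA2 b4 b3 b2 b1 b0 s (s^(4*k+1)) = A2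
  generalize qA3 b4 b3 b2 b1 b0 s (s^(4*k+1)) = A3
  rw [inv_pow s (4*k), e2, e]
  have hz : s^(4*k) ≠ 0 := pow_ne_zero _ hs
  generalize s^(4*k) = z at *
  field_simp
end inf

section hom
variable {R S : Type*} [CommRing R] [CommRing S] (φ : R →+* S) (b0 b1 b2 b3 b4 x X u : R)
lemma map_qF0 : φ (qF0 b0 b1 b2 b3 b4 x) = qF0 (φ b0) (φ b1) (φ b2) (φ b3) (φ b4) (φ x) := by
  simp [map_ofNat, qF0]
lemma map_qF1 : φ (qF1 b0 b1 b2 b3 b4 x X) = qF1 (φ b0) (φ b1) (φ b2) (φ b3) (φ b4) (φ x) (φ X) := by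
  simp [map_ofNat, qF1]
lemma map_qF2 : φ (qF2 b0 b1 b2 b3 b4 x X) = qF2 (φ b0) (φ b1) (φ b2) (φ b3) (φ b4) (φ x) (φ X) := by
  simp [map_ofNat, qF2]
lemma map_qH : φ (qH b0 b1 b2 b3 b4 x) = qH (φ b0) (φ b1) (φ b2) (φ b3) (φ b4) (φ x) := by
  simp [map_ofNat, qH]
lemma map_qJ : φ (qJ b0 b1 b2 b3 b4 x) = qJ (φ b0) (φ b1) (φ b2) (φ b3) (φ b4) (φ x) := by
  simp [map_ofNat, qJ]
lemma map_qN : φ (qN b0 b1 b2 b3 b4 x X) = qN (φ b0) (φ b1) (φ b2) (φ b3) (φ b4) (φ x) (φ X) := by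
  simp [map_ofNat, qN, qNa, qN1]
lemma map_qM : φ (qM b0 b1 b2 b3 b4 x X) = qM (φ b0) (φ b1) (φ b2) (φ b3) (φ b4) (φ x) (φ X) := by
  simp [map_ofNat, qM, map_qH, map_qF1, map_qJ]
lemma map_qA3 : φ (qA3 b0 b1 b2 b3 b4 x X) = qA3 (φ b0) (φ b1) (φ b2) (φ b3) (φ b4) (φ x) (φ X) := by
  simp [qA3, map_qF0, map_qM]
lemma map_qA2 : φ (qA2 b0 b1 b2 b3 b4 x X) = qA2 (φ b0) (φ b1) (φ b2) (φ b3) (φ b4) (φ x) (φ X) := by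
  simp [map_ofNat, qA2, qα, map_qF0, map_qM, map_qF1, map_qH]
lemma map_qA1 : φ (qA1 b0 b1 b2 b3 b4 x X) = qA1 (φ b0) (φ b1) (φ b2) (φ b3) (φ b4) (φ x) (φ X) := by
  simp [map_ofNat, qA1, map_qM, map_qF1, map_qH]
lemma map_qA0 : φ (qA0 b0 b1 b2 b3 b4 x X) = qA0 (φ b0) (φ b1) (φ b2) (φ b3) (φ b4) (φ x) (φ X) := by
  simp [map_ofNat, qA0, map_qJ, map_qF1, map_qF2, map_qN, map_qH]
lemma map_qPsi : φ (qPsi b0 b1 b2 b3 b4 x X u)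
    = qPsi (φ b0) (φ b1) (φ b2) (φ b3) (φ b4) (φ x) (φ X) (φ u) := by
  simp [qPsi, map_qA0, map_qA1, map_qA2, map_qA3]
end hom

/-- degree bound from behaviour at infinity -/
lemma psi_degree {K : Type*} [Field K] (b0 b1 b2 b3 b4 : K) (k : ℕ)
    (hd : X^4 ∣ qPsi (C b4) (C b3) (C b2) (C b1) (C b0) (X : K[X]) (X^(4*k+1))
      ((qF0 (C b4) (C b3) (C b2) (C b1) (C b0) X)^k)) :
    (qPsi (C b0) (C b1) (C b2) (C b3) (C b4) (X : K[X]) (X^(4*k+1))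
      ((qF0 (C b0) (C b1) (C b2) (C b3) (C b4) X)^k)).natDegree ≤ 16*k+12 := by
  set P := qPsi (C b0) (C b1) (C b2) (C b3) (C b4) (X : K[X]) (X^(4*k+1))
      ((qF0 (C b0) (C b1) (C b2) (C b3) (C b4) X)^k) with hP
  set P' := qPsi (C b4) (C b3) (C b2) (C b1) (C b0) (X : K[X]) (X^(4*k+1))
      ((qF0 (C b4) (C b3) (C b2) (C b1) (C b0) X)^k) with hP'
  by_cases hP0 : P = 0
  · simp [hP0]
  let L := FractionRing K[X]
  let i : K →+* L := (algebraMap K[X] L).comp C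
  let s : L := algebraMap K[X] L X
  have hinj : Function.Injective (algebraMap K[X] L) := IsFractionRing.injective _ _
  have hs : s ≠ 0 := by
    intro h0
    have : (X : K[X]) = 0 := hinj (by simpa [s] using h0)
    exact X_ne_zero this
  have hev : ∀ Q : K[X], eval₂ i s Q = algebraMap K[X] L Q := by
    intro Q
    have := Polynomial.hom_eval₂ Q C (algebraMap K[X] L) X
    rw [eval₂_C_X] at this
    exact this.symm
  have h1 : eval₂ i s⁻¹ P * s^(16*k+16) = algebraMap K[X] L P' := by
    have e1 : eval₂ i s⁻¹ P = qPsi (i b0) (i b1) (i b2) (i b3) (i b4) s⁻¹ (s^(4*k+1))⁻¹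
        ((qF0 (i b4) (i b3) (i b2) (i b1) (i b0) s)^k * (s⁻¹^(4*k))) := by
      rw [← coe_eval₂RingHom, hP, map_qPsi, map_pow, map_pow, map_qF0]
      simp only [coe_eval₂RingHom, eval₂_C, eval₂_X]
      rw [revF0' _ _ _ _ _ _ hs, mul_pow, ← pow_mul, inv_pow, inv_pow]
    rw [e1, revPsi _ _ _ _ _ _ _ _ hs, hP', map_qPsi, map_pow, map_pow, map_qF0]
    rfl
  let _ : Invertible s⁻¹ := invertibleOfNonzero (inv_ne_zero hs)
  have h2 := eval₂_reverse_mul_pow i s⁻¹ P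
  rw [invOf_eq_inv, inv_inv, hev] at h2
  have h3 : P.reverse * X^(16*k+16) = P' * X^P.natDegree := by
    apply hinj
    rw [map_mul, map_mul, map_pow, map_pow, ← h1, ← h2]
    have e : s⁻¹^P.natDegree * s^P.natDegree = 1 := by
      rw [← mul_pow, inv_mul_cancel₀ hs, one_pow]
    change _ * s^_ = _ * s^_
    linear_combination (-(algebraMap K[X] L) P.reverse * s ^ (16 * k + 16)) * e
  by_contra hcon
  push Not at hcon
  obtain ⟨Q, hQ⟩ := hd
  obtain ⟨m, hm⟩ : ∃ m, P.natDegree = 16*k+12+1+m := ⟨_, (Nat.add_sub_cancel' hcon).symm⟩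
  have h4 : P.reverse = X * (X^m * Q) := by
    have hX : (X:K[X])^(16*k+16) ≠ 0 := pow_ne_zero _ X_ne_zero
    apply mul_right_cancel₀ hX
    rw [h3, hQ, hm]; ring
  have h5 : P.reverse.coeff 0 = P.leadingCoeff := coeff_zero_reverse P
  rw [h4, coeff_X_mul_zero] at h5
  exact hP0 (leadingCoeff_eq_zero.1 h5.symm)
open Polynomial

lemma prod_zmod (p : ℕ) [hp : Fact p.Prime] :
    ∏ c : ZMod p, (X - C c) = (X^p - X : (ZMod p)[X]) := by
  have hr := FiniteField.roots_X_pow_card_sub_X (ZMod p)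
  rw [ZMod.card] at hr
  have hm : (X^p - X : (ZMod p)[X]).Monic := monic_X_pow_sub (by
    rw [degree_X]; exact_mod_cast hp.out.one_lt)
  have := prod_multiset_X_sub_C_of_monic_of_roots_card_eq hm (by
    rw [hr, FiniteField.X_pow_card_sub_X_natDegree_eq _ hp.out.one_lt]
    simp [ZMod.card])
  rw [hr] at this
  exact this

lemma pow_dvd_of_local (p : ℕ) [hp : Fact p.Prime] (n : ℕ) (P : (ZMod p)[X])
    (h : ∀ c : ZMod p, (X - C c)^n ∣ P) : (X^p - X)^n ∣ P := by
  rw [← prod_zmod, ← Finset.prod_pow]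
  apply Finset.prod_dvd_of_coprime
  · intro a _ b _ hab
    exact IsCoprime.pow (pairwise_coprime_X_sub_C (s := id) Function.injective_id hab)
  · intro c _; exact h c

lemma expand_qF0 (p : ℕ) [hp : Fact p.Prime] (b0 b1 b2 b3 b4 : ZMod p) :
    (qF0 (C b0) (C b1) (C b2) (C b3) (C b4) X)^p
      = qF0 (C b0) (C b1) (C b2) (C b3) (C b4) ((X : (ZMod p)[X])^p) := by
  rw [← ZMod.expand_card]
  have := map_qF0 (expand (ZMod p) p : (ZMod p)[X] →+* (ZMod p)[X]) (C b0) (C b1) (C b2) (C b3) (C b4) X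
  simpa using this

lemma local_div' (p k : ℕ) [hp : Fact p.Prime] (hk : p = 4*k+1) (b0 b1 b2 b3 b4 c : ZMod p)
    (hc : (qF0 (C b0) (C b1) (C b2) (C b3) (C b4) X).eval c ≠ 0)
    (h1 : ((qF0 (C b0) (C b1) (C b2) (C b3) (C b4) X).eval c)^k ≠ 1) :
    (X - C c)^4 ∣ qPsi (C b0) (C b1) (C b2) (C b3) (C b4) X (X^(4*k+1))
      ((qF0 (C b0) (C b1) (C b2) (C b3) (C b4) X)^k) := by
  rw [← hk]
  have h2 : (2 : ZMod p) ≠ 0 := by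
    intro h0
    have : ((2:ℕ) : ZMod p) = 0 := by exact_mod_cast h0
    rw [ZMod.natCast_eq_zero_iff] at this
    have := Nat.le_of_dvd (by norm_num) this
    have := hp.out.two_le
    omega
  refine local_div h2 b0 b1 b2 b3 b4 c _ (X^p) _ ?_ ?_ hc rfl ?_
  · rw [dvd_iff_isRoot]; simp [ZMod.pow_card]
  · rw [← expand_qF0, ← pow_mul, ← pow_succ]; congr 1; omega
  · have h4 : ((eval c (qF0 (C b0) (C b1) (C b2) (C b3) (C b4) X))^k)^4 = 1 := by
      rw [← pow_mul]
      have := ZMod.pow_card_sub_one_eq_one hc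
      rwa [show p - 1 = k*4 by omega] at this
    rw [eval_pow]
    apply mul_left_cancel₀ (sub_ne_zero.2 h1)
    linear_combination h4

lemma psi_factor (p k : ℕ) [hp : Fact p.Prime] (hk : p = 4*k+1) (b0 b1 b2 b3 b4 : ZMod p)
    (hc : ∀ c, (qF0 (C b0) (C b1) (C b2) (C b3) (C b4) X).eval c ≠ 0)
    (h1 : ∀ c, ((qF0 (C b0) (C b1) (C b2) (C b3) (C b4) X).eval c)^k ≠ 1)
    (hb : b0 ≠ 0) (hb1 : b0^k ≠ 1) :
    ∃ R : (ZMod p)[X], R.natDegree ≤ 8 ∧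
      qPsi (C b0) (C b1) (C b2) (C b3) (C b4) X (X^p)
      ((qF0 (C b0) (C b1) (C b2) (C b3) (C b4) X)^k) = R * (X^p - X)^4 := by
  have hd := psi_degree b0 b1 b2 b3 b4 k (by
    have hev : eval 0 (qF0 (C b4) (C b3) (C b2) (C b1) (C b0) X) = b0 := by simp [qF0]
    have := local_div' p k hk b4 b3 b2 b1 b0 0 (by rwa [hev]) (by rwa [hev])
    simpa using this)
  obtain ⟨R, hR⟩ := pow_dvd_of_local p 4 _ (fun c => local_div' p k hk b0 b1 b2 b3 b4 c (hc c) (h1 c))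
  rw [← hk] at hR hd
  refine ⟨R, ?_, by rw [hR, mul_comm]⟩
  by_cases hR0 : R = 0
  · simp [hR0]
  rw [hR, natDegree_mul (pow_ne_zero _ (FiniteField.X_pow_card_sub_X_ne_zero _ hp.out.one_lt)) hR0,
    natDegree_pow, FiniteField.X_pow_card_sub_X_natDegree_eq _ hp.out.one_lt] at hd
  omega
open Polynomial
section deg
variable {R : Type*} [CommRing R] (b0 b1 b2 b3 b4 Y : R)
lemma dmul {f g : R[X]} (m n k : ℕ) (hf : f.natDegree ≤ m) (hg : g.natDegree ≤ n) (h : m + n ≤ k) :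
    (f*g).natDegree ≤ k := (natDegree_mul_le_of_le hf hg).trans h
lemma dadd {f g : R[X]} {k : ℕ} (hf : f.natDegree ≤ k) (hg : g.natDegree ≤ k) :
    (f+g).natDegree ≤ k := natDegree_add_le_of_degree_le hf hg
lemma dsub {f g : R[X]} {k : ℕ} (hf : f.natDegree ≤ k) (hg : g.natDegree ≤ k) :
    (f-g).natDegree ≤ k := natDegree_sub_le_of_le hf hg |>.trans (by simp)
lemma dpow {f : R[X]} (m e k : ℕ) (hf : f.natDegree ≤ m) (h : e*m ≤ k) :
    (f^e).natDegree ≤ k := (natDegree_pow_le_of_le e hf).trans h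
lemma dnum (n : ℕ) [n.AtLeastTwo] : (OfNat.ofNat n : R[X]).natDegree ≤ 0 := by simp
lemma dF0 : (qF0 (C b0) (C b1) (C b2) (C b3) (C b4) X).natDegree ≤ 4 := by
  unfold qF0; compute_degree
lemma dF4 : (qF0 (C b0) (C b1) (C b2) (C b3) (C b4) (C Y)).natDegree ≤ 0 := by
  unfold qF0; compute_degree
lemma dF1 : (qF1 (C b0) (C b1) (C b2) (C b3) (C b4) X (C Y)).natDegree ≤ 3 := by
  unfold qF1; compute_degree
lemma dF2 : (qF2 (C b0) (C b1) (C b2) (C b3) (C b4) X (C Y)).natDegree ≤ 2 := by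
  unfold qF2; compute_degree
lemma dH : (qH (C b0) (C b1) (C b2) (C b3) (C b4) X).natDegree ≤ 4 := by
  unfold qH; compute_degree
lemma dJ : (qJ (C b0) (C b1) (C b2) (C b3) (C b4) X).natDegree ≤ 6 := by
  unfold qJ; compute_degree
lemma dN : (qN (C b0) (C b1) (C b2) (C b3) (C b4) X (C Y)).natDegree ≤ 5 := by
  unfold qN qNa qN1; compute_degree
lemma dT : (C Y - X : R[X]).natDegree ≤ 1 := by compute_degree
lemma dM : (qM (C b0) (C b1) (C b2) (C b3) (C b4) X (C Y)).natDegree ≤ 7 := by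
  unfold qM
  apply dsub
  · apply dmul 4 3 7 _ (dF1 ..) (by norm_num)
    apply dmul 0 4 4 (dnum 6) (dH ..) (by norm_num)
  · apply dmul 1 6 7 _ (dJ ..) (by norm_num)
    apply dmul 0 1 1 (dnum 4) (dT ..) (by norm_num)
lemma dA3 : (qA3 (C b0) (C b1) (C b2) (C b3) (C b4) X (C Y)).natDegree ≤ 15 := by
  unfold qA3
  exact dmul 8 7 15 (dpow 4 2 8 (dF0 ..) (by norm_num)) (dM ..) (by norm_num)
lemma dT2H2 (n : ℕ) [n.AtLeastTwo] : ((OfNat.ofNat n : R[X]) * (C Y - X)^2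
    * (qH (C b0) (C b1) (C b2) (C b3) (C b4) X)^2).natDegree ≤ 10 := by
  apply dmul 2 8 10 _ (dpow 4 2 8 (dH ..) (by norm_num)) (by norm_num)
  exact dmul 0 2 2 (dnum n) (dpow 1 2 2 (dT ..) (by norm_num)) (by norm_num)
lemma dA2 : (qA2 (C b0) (C b1) (C b2) (C b3) (C b4) X (C Y)).natDegree ≤ 14 := by
  unfold qA2 qα
  apply dmul 4 10 14 (dF0 ..) _ (by norm_num)
  apply dadd
  · exact dmul 3 7 10 (dF1 ..) (dM ..) (by norm_num)
  · exact dT2H2 ..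
lemma dA1 : (qA1 (C b0) (C b1) (C b2) (C b3) (C b4) X (C Y)).natDegree ≤ 13 := by
  unfold qA1
  apply dadd
  · exact dmul 6 7 13 (dpow 3 2 6 (dF1 ..) (by norm_num)) (dM ..) (by norm_num)
  · exact dmul 10 3 13 (dT2H2 ..) (dF1 ..) (by norm_num)
lemma dA0 : (qA0 (C b0) (C b1) (C b2) (C b3) (C b4) X (C Y)).natDegree ≤ 12 := by
  unfold qA0
  apply dadd
  apply dadd
  · apply dmul 2 10 12 (dF2 ..) _ (by norm_num)
    apply dsub
    · apply dmul 4 6 10 _ (dpow 3 2 6 (dF1 ..) (by norm_num)) (by norm_num)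
      exact dmul 0 4 4 (dnum 6) (dH ..) (by norm_num)
    · apply dmul 7 3 10 _ (dF1 ..) (by norm_num)
      apply dmul 1 6 7 _ (dJ ..) (by norm_num)
      apply dmul 0 1 1 (dnum 4) (dT ..) (by norm_num)
  · exact dmul 10 2 12 (dT2H2 ..) (dF2 ..) (by norm_num)
  · apply dmul 7 5 12 _ (dN ..) (by norm_num)
    apply dmul 3 4 7 _ (dH ..) (by norm_num)
    exact dmul 0 3 3 (dnum 4) (dpow 1 3 3 (dT ..) (by norm_num)) (by norm_num)
end deg

section divT
lemma divT1 {R : Type*} [CommRing R] (F A a H J Q T F4 r : R) (M : R) (hM : M = 6*H*a-4*T*J)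
    (e2 : F^3*F4 = a^4 + 6*T^2*H*a^2+4*T^3*J*a+T^4*Q)
    (e4 : F*A = a^3*M+27*T^2*H^2*a^2+13*T^4*H^3) :
    T^4 ∣ F*(F*(A - r*T^4)^2 + F4*((F*(a*M+9*T^2*H^2))^2
      - 2*(a^2*M+18*T^2*H^2*a)*(F^2*M))) := by
  have : F*(F*(A - r*T^4)^2 + F4*((F*(a*M+9*T^2*H^2))^2
      - 2*(a^2*M+18*T^2*H^2*a)*(F^2*M)))
      = (F*A - F*r*T^4)^2 + (F^3*F4)*((a*M+9*T^2*H^2)^2 - 2*(a^2*M+18*T^2*H^2*a)*M) := by ring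
  rw [this, e2, e4]
  refine ⟨16*a^3*M*J^2+729*H^4*a^4-18*(6*H*a^2+4*T*J*a)*H^2*a*M
    + 2*(a^3*M+27*T^2*H^2*a^2)*(13*H^3-F*r)+T^4*(13*H^3-F*r)^2
    + Q*((a*M+9*T^2*H^2)^2 - 2*(a^2*M+18*T^2*H^2*a)*M)
    + 81*H^4*(a^4 + 6*T^2*H*a^2+4*T^3*J*a), ?_⟩
  rw [hM]; ring
lemma divT2 {R : Type*} [CommRing R] (F A a H J Q T F4 r : R) (M : R) (hM : M = 6*H*a-4*T*J)
    (e2 : F^3*F4 = a^4 + 6*T^2*H*a^2+4*T^3*J*a+T^4*Q)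
    (e4 : F*A = a^3*M+27*T^2*H^2*a^2+13*T^4*H^3) :
    T^4 ∣ F*(2*(A - r*T^4)*(F*(a*M+9*T^2*H^2)) - (a^2*M+18*T^2*H^2*a)^2) - F4*(F^2*M)^2 := by
  have : F*(2*(A - r*T^4)*(F*(a*M+9*T^2*H^2)) - (a^2*M+18*T^2*H^2*a)^2) - F4*(F^2*M)^2
      = F*(2*(F*A - F*r*T^4)*(a*M+9*T^2*H^2) - (a^2*M+18*T^2*H^2*a)^2 - (F^3*F4)*M^2) := by ring
  rw [this, e2, e4]
  refine ⟨F*(16*a*M*J^2+162*H^4*a^2+2*(13*H^3-F*r)*(a*M+9*T^2*H^2)-Q*M^2), ?_⟩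
  rw [hM]; ring
end divT
open Polynomial

lemma theta_inj {K : Type*} [Field K] (p : ℕ) (hp : 0 < p) (n : K[X][X]) (hn : n.natDegree < p)
    (h : eval₂ (expand K p : K[X] →+* K[X]) X n = 0) : n = 0 := by
  ext i k
  by_cases hi : i < p
  swap
  · have h0 : n.coeff i = 0 := coeff_eq_zero_of_natDegree_lt (by omega)
    rw [h0]; simp
  have h2 : coeff (eval₂ (expand K p : K[X] →+* K[X]) X n) (p*k+i) = coeff 0 (p*k+i) := by rw [h]
  rw [eval₂_eq_sum_range' _ hn, finsetSum_coeff, Finset.sum_eq_single i] at h2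
  · rw [coeff_mul_X_pow'] at h2
    simpa [coeff_expand hp, hp] using h2
  · intro j hj hji
    rw [Finset.mem_range] at hj
    rw [coeff_mul_X_pow']
    split_ifs with hle
    · simp only [RingHom.coe_coe, coeff_expand hp]
      rw [if_neg]
      rintro ⟨m, hm⟩
      have h3 : p*k + i = p*m+j := by omega
      have h4 := congrArg (· % p) h3
      simp only [Nat.mul_add_mod, Nat.mod_eq_of_lt hi, Nat.mod_eq_of_lt hj] at h4
      omega
    · rfl
  · intro h3; simp at h3; omega

lemma parity {R : Type*} [CommRing R] [IsDomain R] [UniqueFactorizationMonoid R]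
    (q A B d0 d1 : R) (hq : Prime q) (hA : ¬ q ∣ A) (hB : ¬ q ∣ B)
    (h : A * d0^2 = q * B * d1^2) : d0 = 0 ∧ d1 = 0 := by
  have key : ∀ n : ℕ, ∀ d0 d1 : R, A * d0^2 = q * B * d1^2 → q^n ∣ d1 := by
    intro n
    induction n with
    | zero => intro d0 d1 _; simp
    | succ n ih =>
      intro d0 d1 h
      have h1 : q ∣ A * d0^2 := ⟨B*d1^2, by rw [h]; ring⟩
      obtain ⟨e0, rfl⟩ := hq.dvd_of_dvd_pow ((hq.dvd_or_dvd h1).resolve_left hA)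
      have h2 : A * q * e0^2 = B * d1^2 := by
        apply mul_left_cancel₀ hq.ne_zero
        linear_combination h
      have h3 : q ∣ B * d1^2 := ⟨A*e0^2, by rw [← h2]; ring⟩
      obtain ⟨e1, rfl⟩ := hq.dvd_of_dvd_pow ((hq.dvd_or_dvd h3).resolve_left hB)
      have h4 : A * e0^2 = q * B * e1^2 := by
        apply mul_left_cancel₀ hq.ne_zero
        linear_combination h2
      obtain ⟨w, hw⟩ := ih _ _ h4
      exact ⟨w, by rw [hw]; ring⟩
  have hd1 : d1 = 0 := by
    by_contra hne
    obtain ⟨n, hn⟩ := FiniteMultiplicity.of_prime_left hq hne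
    exact hn (key _ _ _ h)
  refine ⟨?_, hd1⟩
  rw [hd1] at h
  have hA0 : A ≠ 0 := by rintro rfl; simp at hA
  simpa [hA0] using h
open Polynomial

lemma qF0_coeff4 {R : Type*} [CommRing R] (b0 b1 b2 b3 b4 : R) :
    (qF0 (C b0) (C b1) (C b2) (C b3) (C b4) X).coeff 4 = b0 := by
  have : qF0 (C b0) (C b1) (C b2) (C b3) (C b4) X
    = C b0*X^4+C (4*b1)*X^3+C (6*b2)*X^2+C (4*b3)*X+C b4 := by
    unfold qF0; simp only [C_mul, map_ofNat]
  rw [this]; simp only [coeff_add, coeff_C_mul, coeff_X_pow, coeff_X, coeff_C]; norm_num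

lemma qF0_natDegree {R : Type*} [CommRing R] (b0 b1 b2 b3 b4 : R) (hb : b0 ≠ 0) :
    (qF0 (C b0) (C b1) (C b2) (C b3) (C b4) X).natDegree = 4 := by
  apply le_antisymm (dF0 ..)
  apply le_natDegree_of_ne_zero
  rwa [qF0_coeff4]

lemma endgame {K : Type*} [Field K] (h6 : (6:K) ≠ 0) (b0 b1 b2 b3 b4 : K)
    (hb : b0 ≠ 0) (f : K[X]) (hf : f = qF0 (C b0) (C b1) (C b2) (C b3) (C b4) X)
    (hc : ∀ c, f.eval c ≠ 0) (hsq : Squarefree f)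
    (F0 a0 a1 a2 d0 d1 T4 M : K[X][X])
    (hF0 : F0 = qF0 (C (C b0)) (C (C b1)) (C (C b2)) (C (C b3)) (C (C b4)) X)
    (hM : M = qM (C (C b0)) (C (C b1)) (C (C b2)) (C (C b3)) (C (C b4)) X (C X))
    (hn : F0 * d0^2 - C f * d1^2 = 0)
    (e0 : F0*a0^2 + C f*(a2^2 - 2*a1*(F0^2*M)) = T4 * d0)
    (e1 : F0*(2*a0*a2 - a1^2) - C f*(F0^2*M)^2 = T4 * d1) : False := by
  have hfu : ¬ IsUnit f := by
    intro hu
    obtain ⟨c, hc1, hc2⟩ := Polynomial.isUnit_iff.1 hu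
    have : f.coeff 4 = b0 := by rw [hf, qF0_coeff4]
    rw [← hc2] at this
    simp at this
    exact hb this.symm
  have hf0 : f ≠ 0 := by rintro rfl; exact hc 0 (by simp)
  obtain ⟨π, hπ, ρ, hρ⟩ := WfDvdMonoid.exists_irreducible_factor hfu hf0
  have hπρ : ¬ π ∣ ρ := by
    rintro ⟨w, rfl⟩
    exact hπ.not_isUnit (hsq π ⟨w, by rw [hρ]; ring⟩)
  have hπd : 2 ≤ π.natDegree := by
    have h1 := hπ.natDegree_pos
    by_contra hlt
    have h2 : π.natDegree = 1 := by omega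
    obtain ⟨r, hr⟩ := exists_root_of_degree_eq_one ((degree_eq_iff_natDegree_eq_of_pos one_pos).2 h2)
    apply hc r
    rw [hρ, eval_mul, hr.eq_zero, zero_mul]
  have hq : Prime (C π : K[X][X]) := prime_C_iff.2 hπ.prime
  have hqF : ¬ C π ∣ F0 := by
    rw [C_dvd_iff_dvd_coeff]
    intro h
    have h4 := h 4
    have : F0.coeff 4 = C b0 := by rw [hF0, qF0_coeff4]
    rw [this] at h4
    exact hπ.not_isUnit (isUnit_of_dvd_unit h4 (isUnit_C.2 hb.isUnit))
  have hqρ : ¬ C π ∣ (C ρ : K[X][X]) := by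
    rw [C_dvd_iff_dvd_coeff]
    intro h; apply hπρ; simpa using h 0
  have hCf : (C f : K[X][X]) = C π * C ρ := by rw [hρ, C_mul]
  obtain ⟨rfl, rfl⟩ := parity (C π) F0 (C ρ) d0 d1 hq hqF hqρ (by rw [← hCf]; exact sub_eq_zero.1 hn)
  rw [mul_zero, hCf] at e0 e1
  obtain ⟨c0, rfl⟩ : C π ∣ a0 := by
    have : C π ∣ F0 * a0^2 := ⟨-(C ρ*(a2^2 - 2*a1*(F0^2*M))), by linear_combination e0⟩
    exact hq.dvd_of_dvd_pow ((hq.dvd_or_dvd this).resolve_left hqF)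
  obtain ⟨c1, rfl⟩ : C π ∣ a1 := by
    have : C π ∣ F0 * a1^2 := ⟨F0*2*c0*a2 - C ρ*(F0^2*M)^2, by linear_combination -e1⟩
    exact hq.dvd_of_dvd_pow ((hq.dvd_or_dvd this).resolve_left hqF)
  obtain ⟨c2, rfl⟩ : C π ∣ a2 := by
    have : C π ∣ C ρ * a2^2 := by
      refine ⟨C ρ*2*c1*(F0^2*M) - F0*c0^2, ?_⟩
      apply mul_left_cancel₀ hq.ne_zero
      linear_combination e0
    exact hq.dvd_of_dvd_pow ((hq.dvd_or_dvd this).resolve_left hqρ)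
  have hqM : C π ∣ M := by
    have : C π ∣ C ρ * (F0^2*M)^2 := by
      refine ⟨F0*(2*c0*c2-c1^2), ?_⟩
      apply mul_left_cancel₀ hq.ne_zero
      linear_combination -e1
    have := hq.dvd_of_dvd_pow ((hq.dvd_or_dvd this).resolve_left hqρ)
    exact (hq.dvd_or_dvd this).resolve_left (fun h => hqF (hq.dvd_of_dvd_pow h))
  have hM0 : M = 0 := by
    obtain ⟨P, Q, hPQ⟩ : ∃ P Q : K[X], M = P.map C + C X * Q.map C := by
      refine ⟨6*qH (C b0) (C b1) (C b2) (C b3) (C b4) X*(C b1*X^3+3*C b2*X^2+3*C b3*X+C b4)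
        + 4*X*qJ (C b0) (C b1) (C b2) (C b3) (C b4) X,
        6*qH (C b0) (C b1) (C b2) (C b3) (C b4) X*(C b0*X^3+3*C b1*X^2+3*C b2*X+C b3)
        - 4*qJ (C b0) (C b1) (C b2) (C b3) (C b4) X, ?_⟩
      have hH := map_qH (mapRingHom (C : K →+* K[X])) (C b0) (C b1) (C b2) (C b3) (C b4) X
      have hJ := map_qJ (mapRingHom (C : K →+* K[X])) (C b0) (C b1) (C b2) (C b3) (C b4) X
      simp only [coe_mapRingHom, map_C, map_X] at hH hJ
      rw [hM]; unfold qM qF1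
      simp only [Polynomial.map_add, Polynomial.map_mul, Polynomial.map_sub, Polynomial.map_pow,
        map_C, map_X, hH, hJ, Polynomial.map_ofNat]
      ring
    rw [C_dvd_iff_dvd_coeff] at hqM
    ext1 i
    have h1 := hqM i
    rw [coeff_zero]
    have h2 : M.coeff i = C (P.coeff i) + X * C (Q.coeff i) := by
      rw [hPQ, coeff_add, coeff_C_mul, coeff_map, coeff_map]
    apply eq_zero_of_dvd_of_natDegree_lt h1
    refine lt_of_le_of_lt ?_ hπd
    rw [h2]; compute_degree
  have hH0 : qH (C b0) (C b1) (C b2) (C b3) (C b4) X = (0:K[X]) := by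
    have h1 := map_qM (evalRingHom (X : K[X])) (C (C b0)) (C (C b1)) (C (C b2)) (C (C b3)) (C (C b4)) X (C X)
    rw [← hM, hM0] at h1
    simp only [map_zero, coe_evalRingHom, eval_C, eval_X] at h1
    unfold qM at h1
    rw [qF1_diag, ← hf, sub_self, mul_zero, zero_mul, sub_zero, eq_comm, mul_eq_zero, mul_eq_zero] at h1
    have h60 : (6 : K[X]) ≠ 0 := by
      intro h; apply h6
      have := congrArg (eval 0) h
      simpa using this
    tauto
  have h5 := qid5 (C b0) (C b1) (C b2) (C b3) (C b4) (X : K[X])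
  rw [hH0, ← hf] at h5
  have h7 : f ∣ (C b0*X^3+3*C b1*X^2+3*C b2*X+C b3)^2 := ⟨_, (sub_eq_zero.1 h5.symm).symm⟩
  have h8 := hsq.isRadical _ _ h7
  have h9 : C b0*X^3+3*C b1*X^2+3*C b2*X+C b3 = 0 := by
    apply eq_zero_of_dvd_of_natDegree_lt h8
    rw [hf, qF0_natDegree _ _ _ _ _ hb]
    have : (C b0*X^3+3*C b1*X^2+3*C b2*X+C b3).natDegree ≤ 3 := by compute_degree
    omega
  have h10 : C b0*X^3+3*C b1*X^2+3*C b2*X+C b3 = C b0*X^3+C (3*b1)*X^2+C (3*b2)*X+C b3 := by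
    simp only [C_mul, map_ofNat]
  rw [h10] at h9
  have h11 := congrArg (fun P => coeff P 3) h9
  simp only [coeff_add, coeff_C_mul, coeff_X_pow, coeff_X, coeff_C, coeff_zero] at h11
  norm_num at h11
  exact hb h11
open Polynomial

set_option maxHeartbeats 2000000 in
lemma main_one (p k : ℕ) [hp : Fact p.Prime] (hk : p = 4*k+1) (hp53 : 53 ≤ p)
    (b0 b1 b2 b3 b4 : ZMod p)
    (hc : ∀ c, (qF0 (C b0) (C b1) (C b2) (C b3) (C b4) X).eval c ≠ 0)
    (h1 : ∀ c, ((qF0 (C b0) (C b1) (C b2) (C b3) (C b4) X).eval c)^k ≠ 1)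
    (hb : b0 ≠ 0) (hb1 : b0^k ≠ 1)
    (hsq : Squarefree (qF0 (C b0) (C b1) (C b2) (C b3) (C b4) X)) : False := by
  obtain ⟨R, hRd, hR⟩ := psi_factor p k hk b0 b1 b2 b3 b4 hc h1 hb hb1
  set f := qF0 (C b0) (C b1) (C b2) (C b3) (C b4) X with hf
  let θ : (ZMod p)[X][X] →+* (ZMod p)[X] :=
    eval₂RingHom (expand (ZMod p) p : (ZMod p)[X] →+* (ZMod p)[X]) X
  have θC : ∀ b : ZMod p, θ (C (C b)) = C b := by intro b; simp [θ]
  have θx : θ X = X := by simp [θ]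
  have θX : θ (C X) = X^p := by simp [θ]
  have θR : θ (R.map C) = R := by
    simp only [θ, coe_eval₂RingHom, eval₂_map]
    have : (expand (ZMod p) p : (ZMod p)[X] →+* (ZMod p)[X]).comp C = C := by ext; simp
    rw [this, eval₂_C_X]
  set F0 := qF0 (C (C b0)) (C (C b1)) (C (C b2)) (C (C b3)) (C (C b4)) (X : (ZMod p)[X][X]) with hF0
  have hF4 : C f = qF0 (C (C b0)) (C (C b1)) (C (C b2)) (C (C b3)) (C (C b4)) (C X : (ZMod p)[X][X]) := by
    rw [hf, map_qF0]
  set M := qM (C (C b0)) (C (C b1)) (C (C b2)) (C (C b3)) (C (C b4)) (X : (ZMod p)[X][X]) (C X) with hM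
  set A0 := qA0 (C (C b0)) (C (C b1)) (C (C b2)) (C (C b3)) (C (C b4)) (X : (ZMod p)[X][X]) (C X) with hA0
  set A1 := qA1 (C (C b0)) (C (C b1)) (C (C b2)) (C (C b3)) (C (C b4)) (X : (ZMod p)[X][X]) (C X) with hA1
  set A2 := qA2 (C (C b0)) (C (C b1)) (C (C b2)) (C (C b3)) (C (C b4)) (X : (ZMod p)[X][X]) (C X) with hA2
  set A3 := qA3 (C (C b0)) (C (C b1)) (C (C b2)) (C (C b3)) (C (C b4)) (X : (ZMod p)[X][X]) (C X) with hA3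
  set T : (ZMod p)[X][X] := C X - X with hT
  have hA3M : A3 = F0^2*M := rfl
  set a0 := A0 - R.map C * T^4 with ha0
  have θF0 : θ F0 = f := by rw [hF0, map_qF0]; simp only [θC, θx]; rfl
  have θF4 : θ (C f) = f^p := by rw [hF4, map_qF0, expand_qF0]; simp only [θC, θX]
  have θT : θ T = X^p - X := by rw [hT, map_sub, θX, θx]
  have θT0 : θ T ≠ 0 := by rw [θT]; exact FiniteField.X_pow_card_sub_X_ne_zero _ hp.out.one_lt
  have θrel : θ a0 + θ A1 * f^k + θ A2 * (f^k)^2 + θ A3 * (f^k)^3 = 0 := by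
    rw [ha0, map_sub, map_mul, map_pow, θR, θT, ← hR, hA0, hA1, hA2, hA3, map_qA0, map_qA1,
      map_qA2, map_qA3]
    simp only [θC, θx, θX, qPsi]
    ring
  set u := f^k with hu
  have hu4 : u^4 * f = θ (C f) := by
    rw [θF4, hu, ← pow_mul, ← pow_succ]; congr 1; omega
  have e2 := qid2 (C (C b0)) (C (C b1)) (C (C b2)) (C (C b3)) (C (C b4)) (X : (ZMod p)[X][X]) (C X)
  have e4 := qid4 (C (C b0)) (C (C b1)) (C (C b2)) (C (C b3)) (C (C b4)) (X : (ZMod p)[X][X]) (C X)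
  rw [← hF4, ← hF0, ← hT] at e2
  rw [← hF0, ← hT, ← hA0, ← hM] at e4
  have hA1e : A1 = _ := hA1
  have hA2e : A2 = _ := hA2
  have hMe : M = _ := hM
  rw [qA1, ← hM, ← hT] at hA1e
  rw [qA2, qα, ← hM, ← hT, ← hF0] at hA2e
  rw [qM, ← hT] at hMe
  set a := qF1 (C (C b0)) (C (C b1)) (C (C b2)) (C (C b3)) (C (C b4)) (X : (ZMod p)[X][X]) (C X) with ha
  set H := qH (C (C b0)) (C (C b1)) (C (C b2)) (C (C b3)) (C (C b4)) (X : (ZMod p)[X][X]) with hH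
  set J := qJ (C (C b0)) (C (C b1)) (C (C b2)) (C (C b3)) (C (C b4)) (X : (ZMod p)[X][X]) with hJ
  have D0 : T^4 ∣ F0*a0^2 + C f*(A2^2 - 2*A1*(F0^2*M)) := by
    have h := divT1 F0 A0 a H J _ T (C f) (R.map C) M hMe e2 e4
    rw [← hA1e, ← hA2e, ← ha0] at h
    have hTp : Prime (X - C X : (ZMod p)[X][X]) := prime_X_sub_C X
    have hTe : T^4 = (X - C X)^4 := by rw [hT]; ring
    generalize C f*(A2^2 - 2*A1*(F0^2*M)) = W at h ⊢
    rw [hTe] at h ⊢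
    refine hTp.pow_dvd_of_dvd_mul_left 4 ?_ h
    rw [dvd_iff_isRoot, IsRoot, hF0, ← coe_evalRingHom, map_qF0]
    simp only [coe_evalRingHom, eval_C, eval_X]
    rw [← hf]; exact hsq.ne_zero
  have D1 : T^4 ∣ F0*(2*a0*A2 - A1^2) - C f*(F0^2*M)^2 := by
    have h := divT2 F0 A0 a H J _ T (C f) (R.map C) M hMe e2 e4
    rwa [← hA1e, ← hA2e, ← ha0] at h
  obtain ⟨d0, hd0⟩ := D0
  obtain ⟨d1, hd1⟩ := D1
  have hTd : T.natDegree = 1 := by rw [hT]; compute_degree!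
  have hTne : T ≠ 0 := by rintro h; rw [h] at hTd; simp at hTd
  have da0 : a0.natDegree ≤ 12 := by
    apply dsub (dA0 ..)
    exact dmul 8 4 12 (natDegree_map_le.trans hRd) (dpow 1 4 4 hTd.le (by norm_num)) (by norm_num)
  have dA1' : A1.natDegree ≤ 13 := dA1 ..
  have dA2' : A2.natDegree ≤ 14 := dA2 ..
  have dA3' : (F0^2*M).natDegree ≤ 15 := dA3 ..
  have dF0' : F0.natDegree ≤ 4 := dF0 ..
  have dCf : (C f : (ZMod p)[X][X]).natDegree ≤ 0 := by simp
  have degT : ∀ d : (ZMod p)[X][X], ∀ m, (T^4*d).natDegree ≤ m+4 → d.natDegree ≤ m := by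
    intro d m h
    by_cases hd : d = 0
    · simp [hd]
    rw [natDegree_mul (pow_ne_zero _ hTne) hd, natDegree_pow, hTd] at h
    omega
  have dd0 : d0.natDegree ≤ 24 := by
    apply degT; rw [← hd0]
    apply dadd
    · exact dmul 4 24 28 dF0' (dpow 12 2 24 da0 (by norm_num)) (by norm_num)
    · apply dmul 0 28 28 dCf _ (by norm_num)
      apply dsub
      · exact dpow 14 2 28 dA2' (by norm_num)
      · apply dmul 13 15 28 _ dA3' (by norm_num)
        exact dmul 0 13 13 (dnum 2) dA1' (by norm_num)
  have dd1 : d1.natDegree ≤ 26 := by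
    apply degT; rw [← hd1]
    apply dsub
    · apply dmul 4 26 30 dF0' _ (by norm_num)
      apply dsub
      · apply dmul 12 14 26 _ dA2' (by norm_num)
        exact dmul 0 12 12 (dnum 2) da0 (by norm_num)
      · exact dpow 13 2 26 dA1' (by norm_num)
    · exact dmul 0 30 30 dCf (dpow 15 2 30 dA3' (by norm_num)) (by norm_num)
  have hn : F0 * d0^2 - C f * d1^2 = 0 := by
    apply theta_inj p hp.out.pos
    · have : (F0 * d0^2 - C f * d1^2).natDegree ≤ 52 := by
        apply dsub
        · exact dmul 4 48 52 dF0' (dpow 24 2 48 dd0 (by norm_num)) (by norm_num)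
        · exact dmul 0 52 52 dCf (dpow 26 2 52 dd1 (by norm_num)) (by norm_num)
      omega
    · change θ _ = 0
      have g0 := congrArg θ hd0
      have g1 := congrArg θ hd1
      rw [hA3M] at θrel
      generalize hA3' : F0^2*M = A3' at *
      simp only [map_mul, map_add, map_sub, map_pow, map_ofNat, θF0] at g0 g1 ⊢
      rw [← hu4] at g0 g1 ⊢
      have hz : θ d0 + u^2 * θ d1 = 0 := by
        apply mul_left_cancel₀ (pow_ne_zero 4 θT0)
        linear_combination -g0 - u^2*g1 + f*(θ a0 + u^2*θ A2 - u*(θ A1 + u^2*θ A3'))*θrel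
      linear_combination f * (θ d0 - u^2*θ d1) * hz
  have h6 : (6 : ZMod p) ≠ 0 := by
    intro h0
    have : ((6:ℕ) : ZMod p) = 0 := by exact_mod_cast h0
    rw [ZMod.natCast_eq_zero_iff] at this
    have := Nat.le_of_dvd (by norm_num) this
    omega
  exact endgame h6 b0 b1 b2 b3 b4 hb f hf hc hsq F0 a0 A1 A2 d0 d1 (T^4) M hF0 hM hn hd0 hd1
open Polynomial

lemma zmod_num_ne (p : ℕ) (n : ℕ) (h0 : 0 < n) (h : n < p) : (n : ZMod p) ≠ 0 := by
  intro h1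
  rw [ZMod.natCast_eq_zero_iff] at h1
  have := Nat.le_of_dvd h0 h1
  omega

lemma genus_one (p : ℕ) [hp : Fact p.Prime] (hp7 : 7 ≤ p) (f : (ZMod p)[X])
    (hd : f.natDegree = 4) (hsq : Squarefree f) : ∃ x, IsSquare (f.eval x) := by
  by_contra hno
  push Not at hno
  obtain ⟨m, hm⟩ : ∃ m, p = 2*m+1 := by
    rcases hp.out.eq_two_or_odd' with h | h
    · omega
    · exact h
  have hc0 : ∀ c, f.eval c ≠ 0 := by
    intro c h; apply hno c; rw [h]; exact ⟨0, by simp⟩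
  have hval : ∀ c, (f.eval c)^m = -1 := by
    intro c
    have h1 := ZMod.pow_div_two_eq_neg_one_or_one p (hc0 c)
    rw [show p/2 = m by omega] at h1
    rcases h1 with h1 | h1
    · exfalso; apply hno c
      apply (ZMod.euler_criterion p (hc0 c)).2
      rwa [show p/2 = m by omega]
    · exact h1
  obtain ⟨g, hg⟩ := pow_dvd_of_local p 1 (f^m+1) (fun c => by
    rw [pow_one, dvd_iff_isRoot]; simp [hval c])
  rw [pow_one] at hg
  set W : (ZMod p)[X] := X^p - X with hW
  have hWd : W.natDegree = p := FiniteField.X_pow_card_sub_X_natDegree_eq _ hp.out.one_lt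
  have hW0 : W ≠ 0 := FiniteField.X_pow_card_sub_X_ne_zero _ hp.out.one_lt
  have hW' : derivative W = -1 := by
    rw [hW, derivative_sub, derivative_X_pow, derivative_X, ZMod.natCast_self, C_0]; simp
  set f' := derivative f with hf'
  set g' := derivative g with hg'
  have hf0 : f ≠ 0 := hsq.ne_zero
  have h2m : (2 * (m : (ZMod p)[X])) = -1 := by
    have : ((p:ℕ) : (ZMod p)[X]) = 0 := by
      rw [← map_natCast C, ZMod.natCast_self, C_0]
    have h3 : ((2*m+1 : ℕ) : (ZMod p)[X]) = 0 := by rw [← hm]; exact this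
    push_cast at h3
    linear_combination h3
  have hm1 : f^(m-1) * f = f^m := by rw [← pow_succ]; congr 1; omega
  have e0 : (m : (ZMod p)[X]) * f^(m-1) * f' = -g + W * g' := by
    have := congrArg derivative hg
    rw [derivative_mul, hW', derivative_add, derivative_one, derivative_pow, map_natCast] at this
    linear_combination this
  set Q := 2*f*g' + f'*g with hQ
  have e1 : f' + 2*f*g = W * Q := by
    rw [hQ]
    linear_combination (2*f)*e0 - f'*2*m*hm1 - f'*f^m*h2m + f'*hg
  have hgd : g.natDegree ≤ p - 2 := by
    by_cases hg0 : g = 0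
    · simp [hg0]
    have h1 : (f^m+1).natDegree ≤ m*4 := by
      apply dadd
      · rw [natDegree_pow, hd]
      · simp
    rw [hg, natDegree_mul hW0 hg0, hWd] at h1
    omega
  have hfd : f'.natDegree ≤ 3 := by
    have := natDegree_derivative_le f; rw [← hf'] at this; omega
  have hfd2 : (derivative f').natDegree ≤ 2 := by
    have := natDegree_derivative_le f'; omega
  have hQd : Q.natDegree ≤ 2 := by
    by_cases hQ0 : Q = 0
    · simp [hQ0]
    have h1 : (f' + 2*f*g).natDegree ≤ p+2 := by
      apply dadd (by omega)
      apply dmul 4 (p-2) _ _ hgd (by omega)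
      exact dmul 0 4 4 (dnum 2) hd.le (by norm_num)
    rw [e1, natDegree_mul hW0 hQ0, hWd] at h1
    omega
  have e2 : f'*g = -2*Q + W * derivative Q - derivative f' := by
    have := congrArg derivative e1
    rw [derivative_mul, hW', derivative_add, derivative_mul, derivative_mul] at this
    simp only [derivative_ofNat] at this
    linear_combination this - hQ
  have e3 : W * (f'*Q - 2*f*derivative Q) = f'^2 - 4*f*Q - 2*f*derivative f' := by
    linear_combination (-f')*e1 + 2*f*e2
  have e4 : f'^2 - 4*f*Q - 2*f*derivative f' = 0 := by
    apply eq_zero_of_dvd_of_natDegree_lt ⟨_, e3.symm⟩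
    rw [hWd]
    have : (f'^2 - 4*f*Q - 2*f*derivative f').natDegree ≤ 6 := by
      apply dsub
      apply dsub
      · exact dpow 3 2 6 hfd (by norm_num)
      · exact dmul 4 2 6 (dmul 0 4 4 (dnum 4) hd.le (by norm_num)) hQd (by norm_num)
      · exact dmul 4 2 6 (dmul 0 4 4 (dnum 2) hd.le (by norm_num)) hfd2 (by norm_num)
    omega
  have e5 : f ∣ f'^2 := ⟨4*Q+2*derivative f', by linear_combination e4⟩
  have e6 : f' = 0 := by
    apply eq_zero_of_dvd_of_natDegree_lt (hsq.isRadical _ _ e5)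
    omega
  have e7 : f'.coeff 3 = f.coeff 4 * 4 := by
    rw [hf', coeff_derivative]; norm_num
  rw [e6, coeff_zero, eq_comm, mul_eq_zero] at e7
  rcases e7 with h | h
  · rw [← hd] at h
    exact hf0 (leadingCoeff_eq_zero.1 h)
  · exact zmod_num_ne p 4 (by norm_num) (by omega) (by exact_mod_cast h)

lemma fourth_power (p k : ℕ) [hp : Fact p.Prime] (hk : p = 4*k+1) (a : ZMod p) (ha : a ≠ 0)
    (h1 : a^k = 1) : ∃ z, z ≠ 0 ∧ a = z^4 := by
  obtain ⟨g, hg⟩ := IsCyclic.exists_generator (α := (ZMod p)ˣ)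
  have ho := orderOf_eq_card_of_forall_mem_zpowers hg
  rw [Nat.card_eq_fintype_card, ZMod.card_units p, show p - 1 = 4*k by omega] at ho
  obtain ⟨n, hn⟩ := mem_powers_iff_mem_zpowers.2 (hg (Units.mk0 a ha))
  simp only at hn
  have h2 : g^(n*k) = 1 := by
    rw [pow_mul, hn]; ext; simpa using h1
  have h3 := orderOf_dvd_of_pow_eq_one h2
  rw [ho] at h3
  have hk0 : 0 < k := by have := hp.out.two_le; omega
  obtain ⟨j, rfl⟩ := Nat.dvd_of_mul_dvd_mul_right hk0 h3
  refine ⟨(g^j : (ZMod p)ˣ), Units.ne_zero _, ?_⟩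
  have := congrArg Units.val hn
  simp only [Units.val_mk0] at this
  rw [← this]; push_cast; ring

lemma caseA_core (p : ℕ) [hp : Fact p.Prime] (hp7 : 7 ≤ p) (h A2 A3 A4 : ZMod p) (hh : h ≠ 0) :
    (∃ c m n k : ZMod p, ∀ s t : ZMod p, t^2*(A2*s^2+A3*s*t+A4*t^2) = c*(m*s^2+n*s*t+k*t^2)^2) ∨
    (∃ s z : ZMod p, z ≠ 0 ∧ h*z^4 = A2*s^2+A3*s+A4) ∨
    (∃ s : ZMod p, A2*s^2+A3*s+A4 = 0 ∧ 2*A2*s+A3 ≠ 0) := by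
  have h2 : (2:ZMod p) ≠ 0 := by exact_mod_cast zmod_num_ne p 2 (by norm_num) (by omega)
  have h4 : (4:ZMod p) ≠ 0 := by exact_mod_cast zmod_num_ne p 4 (by norm_num) (by omega)
  by_cases hA2 : A2 = 0
  · by_cases hA3 : A3 = 0
    · left; exact ⟨A4, 0, 0, 1, fun s t => by rw [hA2, hA3]; ring⟩
    · right; left
      exact ⟨(h-A4)/A3, 1, one_ne_zero, by rw [hA2]; field_simp; ring⟩
  by_cases hsq : IsSquare (A3^2-4*A2*A4)
  · obtain ⟨δ, hδ⟩ := hsq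
    by_cases hδ0 : δ = 0
    · left
      refine ⟨(4*A2)⁻¹, 0, 2*A2, A3, fun s t => ?_⟩
      rw [hδ0] at hδ
      field_simp
      linear_combination (-t^4)*hδ
    · right; right
      refine ⟨(δ-A3)/(2*A2), ?_, ?_⟩
      · field_simp; linear_combination -hδ
      · have : 2*A2*((δ-A3)/(2*A2))+A3 = δ := by field_simp; ring
        rwa [this]
  · right; left
    set Δ := A3^2-4*A2*A4 with hΔ
    have hΔ0 : Δ ≠ 0 := by intro h0; apply hsq; rw [h0]; exact ⟨0, by simp⟩
    have hl : 4*A2*h ≠ 0 := mul_ne_zero (mul_ne_zero h4 hA2) hh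
    obtain ⟨z, y, hy⟩ := genus_one p hp7 (C (4*A2*h) * X^4 + C Δ) (by compute_degree!) (by
      apply Separable.squarefree
      refine ⟨C Δ⁻¹, -C (Δ⁻¹/4)*X, ?_⟩
      simp only [derivative_add, derivative_C_mul, derivative_X_pow, derivative_C, add_zero]
      have q1 : (C Δ⁻¹ * C Δ : (ZMod p)[X]) = 1 := by rw [← C_mul, inv_mul_cancel₀ hΔ0, C_1]
      have q2 : (C (Δ⁻¹/4) * C ((4:ℕ):ZMod p) : (ZMod p)[X]) = C Δ⁻¹ := by
        rw [← C_mul]; congr 1; push_cast; field_simp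
      linear_combination q1 - C (4*A2*h)*X^4*q2)
    simp only [eval_add, eval_mul, eval_C, eval_pow, eval_X] at hy
    refine ⟨(y-A3)/(2*A2), z, ?_, ?_⟩
    · rintro rfl
      apply hsq; exact ⟨y, by rw [← hy]; ring⟩
    · field_simp
      linear_combination hy

lemma notsq {K : Type*} [Field K] (f : K[X]) (hd : f.natDegree = 4) (hc : ∀ c, f.eval c ≠ 0)
    (hsq : ¬ Squarefree f) : ∃ c m n k : K, f = C c * (C m * X^2 + C n * X + C k)^2 := by
  unfold Squarefree at hsq
  push Not at hsq
  obtain ⟨q, ⟨r, hr⟩, hq⟩ := hsq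
  have hf0 : f ≠ 0 := by rintro rfl; simp at hd
  have hq0 : q ≠ 0 := by rintro rfl; simp at hr; exact hf0 hr
  have hr0 : r ≠ 0 := by rintro rfl; simp at hr; exact hf0 hr
  have h1 : q.natDegree + q.natDegree + r.natDegree = 4 := by
    rw [← hd, hr, natDegree_mul (mul_ne_zero hq0 hq0) hr0, natDegree_mul hq0 hq0]
  have h2 : q.natDegree ≠ 0 := by
    intro h; apply hq
    rw [isUnit_iff_degree_eq_zero, degree_eq_natDegree hq0, h]; rfl
  have h3 : q.natDegree ≠ 1 := by
    intro h
    obtain ⟨x, hx⟩ := exists_root_of_degree_eq_one ((degree_eq_iff_natDegree_eq_of_pos one_pos).2 h)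
    apply hc x; rw [hr, eval_mul, eval_mul, hx.eq_zero]; simp
  have h4 : r.natDegree = 0 := by omega
  have h5 : q.natDegree ≤ 2 := by omega
  refine ⟨r.coeff 0, q.coeff 2, q.coeff 1, q.coeff 0, ?_⟩
  rw [← eq_quadratic_of_degree_le_two (natDegree_le_iff_degree_le.1 h5), ← eq_C_of_natDegree_eq_zero h4, hr]
  ring
open Polynomial

lemma caseA (p : ℕ) [hp : Fact p.Prime] (hp7 : 7 ≤ p) (h : ZMod p) (hh : h ≠ 0)
    (a0 a1 a2 a3 a4 : ZMod p)
    (hnsq : ¬ ∃ c m n k : ZMod p, ∀ x y : ZMod p,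
      a0*x^4 + a1*x^3*y + a2*x^2*y^2 + a3*x*y^3 + a4*y^4
        = c * (m*x^2 + n*x*y + k*y^2)^2)
    (s1 : ∀ x y : ZMod p, (x ≠ 0 ∨ y ≠ 0) →
      a0*x^4 + a1*x^3*y + a2*x^2*y^2 + a3*x*y^3 + a4*y^4 = 0 →
      4*a0*x^3 + 3*a1*x^2*y + 2*a2*x*y^2 + a3*y^3 = 0 ∧
      a1*x^3 + 2*a2*x^2*y + 3*a3*x*y^2 + 4*a4*y^3 = 0)
    (s2 : ∀ x y z : ZMod p, z ≠ 0 →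
      h*z^4 ≠ a0*x^4 + a1*x^3*y + a2*x^2*y^2 + a3*x*y^3 + a4*y^4)
    (x0 y0 : ZMod p) (he : x0 ≠ 0 ∨ y0 ≠ 0)
    (hr : a0*x0^4 + a1*x0^3*y0 + a2*x0^2*y0^2 + a3*x0*y0^3 + a4*y0^4 = 0) : False := by
  obtain ⟨x1, y1, hD⟩ : ∃ x1 y1 : ZMod p, x0*y1 - x1*y0 ≠ 0 := by
    rcases he with h0 | h0
    · exact ⟨0, 1, by simpa using h0⟩
    · exact ⟨-1, 0, by simpa using h0⟩
  obtain ⟨fx, fy⟩ := s1 x0 y0 he hr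
  obtain ⟨A2, hA2⟩ : ∃ A, A = a0*6*x0^2*x1^2 + a1*(3*x0^2*x1*y1+3*x0*x1^2*y0)
    + a2*(x0^2*y1^2+4*x0*x1*y0*y1+x1^2*y0^2)+a3*(3*x0*y0*y1^2 + 3*x1*y0^2*y1)+a4*6*y0^2*y1^2 :=
    ⟨_, rfl⟩
  obtain ⟨A3, hA3⟩ : ∃ A, A = a0*4*x0*x1^3 + a1*(x1^3*y0+3*x0*x1^2*y1)
    + a2*(2*x0*x1*y1^2+2*x1^2*y0*y1)+a3*(x0*y1^3+3*x1*y0*y1^2)+a4*4*y0*y1^3 := ⟨_, rfl⟩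
  obtain ⟨A4, hA4⟩ : ∃ A, A = a0*x1^4+a1*x1^3*y1+a2*x1^2*y1^2+a3*x1*y1^3+a4*y1^4 := ⟨_, rfl⟩
  have hF : ∀ s t : ZMod p, a0*(s*x0+t*x1)^4 + a1*(s*x0+t*x1)^3*(s*y0+t*y1)
      + a2*(s*x0+t*x1)^2*(s*y0+t*y1)^2 + a3*(s*x0+t*x1)*(s*y0+t*y1)^3 + a4*(s*y0+t*y1)^4
      = t^2*(A2*s^2+A3*s*t+A4*t^2) := by
    intro s t
    rw [hA2, hA3, hA4]
    linear_combination s^4*hr + s^3*t*(x1*fx+y1*fy)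
  rcases caseA_core p hp7 h A2 A3 A4 hh with ⟨c, m, n, k, hG⟩ | ⟨s, z, hz, hG⟩ | ⟨s, hG, hG'⟩
  · apply hnsq
    set D := x0*y1 - x1*y0 with hDd
    refine ⟨c/D^4, m*y1^2 - n*y1*y0 + k*y0^2, -2*m*x1*y1 + n*(x0*y1+x1*y0) - 2*k*x0*y0,
      m*x1^2 - n*x1*x0 + k*x0^2, fun x y => ?_⟩
    have h1 := hF ((x*y1-y*x1)/D) ((x0*y-y0*x)/D)
    rw [hG] at h1
    have ex : (x*y1-y*x1)/D*x0+(x0*y-y0*x)/D*x1 = x := by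
      field_simp; rw [hDd]; ring
    have ey : (x*y1-y*x1)/D*y0+(x0*y-y0*x)/D*y1 = y := by
      field_simp; rw [hDd]; ring
    rw [ex, ey] at h1
    rw [h1]
    field_simp
    ring
  · apply s2 (s*x0+1*x1) (s*y0+1*y1) z hz
    rw [hF, hG]; ring
  · have hne : s*x0+1*x1 ≠ 0 ∨ s*y0+1*y1 ≠ 0 := by
      by_contra hcon
      push Not at hcon
      apply hD
      linear_combination x0*hcon.2 - y0*hcon.1
    obtain ⟨g1, g2⟩ := s1 _ _ hne (by rw [hF]; linear_combination hG)
    apply hG'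
    rw [hA2, hA3]
    linear_combination x0*g1 + y0*g2 - 4*s^3*hr - 3*s^2*(x1*fx+y1*fy)

lemma caseB (p : ℕ) [hp : Fact p.Prime] (hp53 : 53 ≤ p) (h : ZMod p) (hh : h ≠ 0)
    (a0 a1 a2 a3 a4 : ZMod p)
    (hnsq : ¬ ∃ c m n k : ZMod p, ∀ x y : ZMod p,
      a0*x^4 + a1*x^3*y + a2*x^2*y^2 + a3*x*y^3 + a4*y^4
        = c * (m*x^2 + n*x*y + k*y^2)^2)
    (s2 : ∀ x y z : ZMod p, z ≠ 0 →
      h*z^4 ≠ a0*x^4 + a1*x^3*y + a2*x^2*y^2 + a3*x*y^3 + a4*y^4)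
    (hr : ∀ x y : ZMod p, (x ≠ 0 ∨ y ≠ 0) →
      a0*x^4 + a1*x^3*y + a2*x^2*y^2 + a3*x*y^3 + a4*y^4 ≠ 0) : False := by
  have h4 : (4:ZMod p) ≠ 0 := by exact_mod_cast zmod_num_ne p 4 (by norm_num) (by omega)
  have h6 : (6:ZMod p) ≠ 0 := by exact_mod_cast zmod_num_ne p 6 (by norm_num) (by omega)
  obtain ⟨b0, hb0⟩ : ∃ b, a0 = h*b := ⟨a0/h, by field_simp⟩
  obtain ⟨b1, hb1⟩ : ∃ b, a1 = h*(4*b) := ⟨a1/(4*h), by field_simp⟩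
  obtain ⟨b2, hb2⟩ : ∃ b, a2 = h*(6*b) := ⟨a2/(6*h), by field_simp⟩
  obtain ⟨b3, hb3⟩ : ∃ b, a3 = h*(4*b) := ⟨a3/(4*h), by field_simp⟩
  obtain ⟨b4, hb4⟩ : ∃ b, a4 = h*b := ⟨a4/h, by field_simp⟩
  set f := qF0 (C b0) (C b1) (C b2) (C b3) (C b4) X with hf
  have hev : ∀ c, h * f.eval c = a0*c^4 + a1*c^3*1 + a2*c^2*1^2 + a3*c*1^3 + a4*1^4 := by
    intro c
    have := map_qF0 (evalRingHom c) (C b0) (C b1) (C b2) (C b3) (C b4) X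
    simp only [coe_evalRingHom, eval_C, eval_X] at this
    rw [hf, this, hb0, hb1, hb2, hb3, hb4]; unfold qF0; ring
  have hc : ∀ c, f.eval c ≠ 0 := by
    intro c h0
    apply hr c 1 (Or.inr one_ne_zero)
    rw [← hev, h0, mul_zero]
  have hb : b0 ≠ 0 := by
    intro h0; apply hr 1 0 (Or.inl one_ne_zero)
    rw [hb0, h0]; ring
  have hfd : f.natDegree = 4 := qF0_natDegree _ _ _ _ _ hb
  have hsq : Squarefree f := by
    by_contra hcon
    obtain ⟨c, m, n, k, hk⟩ := notsq f hfd hc hcon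
    apply hnsq
    have hk2 : C b0*X^4+C (4*b1)*X^3+C (6*b2)*X^2+C (4*b3)*X+C b4
        = C (c*m^2)*X^4 + C (2*c*m*n)*X^3 + C (c*(n^2+2*m*k))*X^2 + C (2*c*n*k)*X + C (c*k^2) := by
      have e : C b0*X^4+C (4*b1)*X^3+C (6*b2)*X^2+C (4*b3)*X+C b4 = f := by
        rw [hf]; unfold qF0; simp only [C_mul, map_ofNat]
      rw [e, hk]
      simp only [C_mul, C_add, C_pow, map_ofNat]
      ring
    have q4 := congrArg (fun P => coeff P 4) hk2
    have q3 := congrArg (fun P => coeff P 3) hk2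
    have q2 := congrArg (fun P => coeff P 2) hk2
    have q1 := congrArg (fun P => coeff P 1) hk2
    have q0 := congrArg (fun P => coeff P 0) hk2
    simp only [coeff_add, coeff_C_mul, coeff_X_pow, coeff_X, coeff_C] at q0 q1 q2 q3 q4
    norm_num at q0 q1 q2 q3 q4
    refine ⟨h*c, m, n, k, fun x y => ?_⟩
    rw [hb0, hb1, hb2, hb3, hb4, q4, q3, q2, q1, q0]; ring
  have hodd : p % 4 = 1 ∨ p % 4 = 3 := by
    rcases hp.out.eq_two_or_odd with h | h <;> omega
  rcases hodd with hp4 | hp4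
  · obtain ⟨k, hk⟩ : ∃ k, p = 4*k+1 := ⟨p/4, by omega⟩
    refine main_one p k hk hp53 b0 b1 b2 b3 b4 hc ?_ hb ?_ hsq
    · intro c h1
      obtain ⟨z, hz, hz4⟩ := fourth_power p k hk _ (hc c) h1
      apply s2 c 1 z hz
      rw [← hev, hz4]
    · intro h1
      obtain ⟨z, hz, hz4⟩ := fourth_power p k hk _ hb h1
      apply s2 1 0 z hz
      rw [← hz4, hb0]; ring
  · obtain ⟨j, hj⟩ : ∃ j, p = 4*j+3 := ⟨p/4, by omega⟩
    obtain ⟨x, w, hw⟩ := genus_one p (by omega) f hfd hsq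
    have hw0 : w ≠ 0 := by rintro rfl; apply hc x; rw [hw]; simp
    apply s2 x 1 (w^(j+1)) (pow_ne_zero _ hw0)
    rw [← hev, hw, ← pow_mul, show (j+1)*4 = (p-1)+2 by omega, pow_add,
      ZMod.pow_card_sub_one_eq_one hw0]
    ring

/-- For a prime `p > 49` and `p ∤ h`, if the quartic form `F` over `𝔽_p` is not
a constant times the square of a quadratic form, then the projective curve
`h z⁴ = F(x,y)` has a smooth `𝔽_p`-rational point. -/
theorem smooth_point_exists_mod_large_prime (p : ℕ) (hp : p.Prime) (hp49 : 49 < p)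
    (h : ℤ) (hh : ¬ (p:ℤ) ∣ h)
    (a0 a1 a2 a3 a4 : ZMod p)
    (hnsq : ¬ ∃ c m n k : ZMod p, ∀ x y : ZMod p,
      a0*x^4 + a1*x^3*y + a2*x^2*y^2 + a3*x*y^3 + a4*y^4
        = c * (m*x^2 + n*x*y + k*y^2)^2) :
    ∃ x y z : ZMod p, (x ≠ 0 ∨ y ≠ 0 ∨ z ≠ 0) ∧
      (h : ZMod p) * z^4 = a0*x^4 + a1*x^3*y + a2*x^2*y^2 + a3*x*y^3 + a4*y^4 ∧
      (4*a0*x^3 + 3*a1*x^2*y + 2*a2*x*y^2 + a3*y^3 ≠ 0 ∨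
       a1*x^3 + 2*a2*x^2*y + 3*a3*x*y^2 + 4*a4*y^3 ≠ 0 ∨
       4*(h : ZMod p)*z^3 ≠ 0) := by
  haveI : Fact p.Prime := ⟨hp⟩
  have hp53 : 53 ≤ p := by
    by_contra hlt
    push Not at hlt
    interval_cases p <;> revert hp <;> norm_num
  have hh0 : (h : ZMod p) ≠ 0 := by
    intro h0; exact hh ((ZMod.intCast_zmod_eq_zero_iff_dvd h p).1 h0)
  have h4 : (4:ZMod p) ≠ 0 := by exact_mod_cast zmod_num_ne p 4 (by norm_num) (by omega)
  by_contra hno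
  have s2 : ∀ x y z : ZMod p, z ≠ 0 →
      (h : ZMod p)*z^4 ≠ a0*x^4 + a1*x^3*y + a2*x^2*y^2 + a3*x*y^3 + a4*y^4 := by
    intro x y z hz heq
    exact hno ⟨x, y, z, Or.inr (Or.inr hz), heq,
      Or.inr (Or.inr (mul_ne_zero (mul_ne_zero h4 hh0) (pow_ne_zero _ hz)))⟩
  have s1 : ∀ x y : ZMod p, (x ≠ 0 ∨ y ≠ 0) →
      a0*x^4 + a1*x^3*y + a2*x^2*y^2 + a3*x*y^3 + a4*y^4 = 0 →
      4*a0*x^3 + 3*a1*x^2*y + 2*a2*x*y^2 + a3*y^3 = 0 ∧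
      a1*x^3 + 2*a2*x^2*y + 3*a3*x*y^2 + 4*a4*y^3 = 0 := by
    intro x y hxy h0
    by_contra hcon
    rw [not_and_or] at hcon
    refine hno ⟨x, y, 0, ?_, ?_, ?_⟩
    · tauto
    · rw [h0]; ring
    · tauto
  by_cases hroot : ∃ x y : ZMod p, (x ≠ 0 ∨ y ≠ 0) ∧
      a0*x^4 + a1*x^3*y + a2*x^2*y^2 + a3*x*y^3 + a4*y^4 = 0
  · obtain ⟨x0, y0, he, hr⟩ := hroot
    exact caseA p (by omega) h hh0 a0 a1 a2 a3 a4 hnsq s1 s2 x0 y0 he hr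
  · exact caseB p hp53 h hh0 a0 a1 a2 a3 a4 hnsq s2
      (fun x y hxy h0 => hroot ⟨x, y, hxy, h0⟩)
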